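/- Let M(N) = |{ i·j : 0 ≤ i < N, 0 ≤ j < N }|. Then M(N) ≥ N²/(2 log N) for all integers N ≥ 4. -/

import Mathlib

/-- `M(N)` is the number of distinct products `i·j` with `0 ≤ i, j < N`. -/
def multTable (N : ℕ) : ℕ :=
  (((Finset.range N) ×ˢ (Finset.range N)).image fun p => p.1 * p.2).card

open Finset in
lemma mt_count (a N d : ℕ) (ha : 1 ≤ a) (hN : a < N) (hd : 1 ≤ d) :
    d * #{x ∈ Ico a N | d ∣ x} ≤ (N - 1 - a) + d := by
  have h1 : #{x ∈ Ico a N | d ∣ x} + #{x ∈ Ioc 0 (a - 1) | d ∣ x} ≤ #{x ∈ Ioc 0 (N - 1) | d ∣ x} := by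
    rw [← card_union_of_disjoint]
    · apply card_le_card
      intro x
      simp only [mem_union, mem_filter, mem_Ico, mem_Ioc]
      rintro (h | h) <;> refine ⟨?_, h.2⟩ <;> omega
    · rw [Finset.disjoint_left]
      intro x
      simp only [mem_filter, mem_Ico, mem_Ioc]
      omega
  rw [Nat.Ioc_filter_dvd_card_eq_div, Nat.Ioc_filter_dvd_card_eq_div] at h1
  have h2 := Nat.mul_le_mul_left d h1
  have h3 : d * ((N - 1) / d) ≤ N - 1 := Nat.mul_div_le _ _
  have h4 := Nat.div_add_mod (a - 1) d
  have h5 := Nat.mod_lt (a - 1) hd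
  rw [mul_add] at h2
  omega

/-- Computable upper bound for the multiplicative energy. -/
def mtE (a N : ℕ) : ℕ :=
  ∑ i ∈ Finset.range (N - a), ∑ j ∈ Finset.range (N - a),
    (N - 1) / (max (a + i) (a + j) / Nat.gcd (a + i) (a + j))

open Finset in
lemma mt_pair_aux (i k n : ℕ) (hi : 1 ≤ i) (hik : i ≤ k) :
    #{x ∈ Ico 1 (n + 1) ×ˢ Ico 1 (n + 1) | i * x.1 = k * x.2} ≤ n / (k / Nat.gcd i k) := by
  rw [← Nat.Ioc_filter_dvd_card_eq_div]
  apply card_le_card_of_injOn (fun x => x.1)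
  · intro x
    simp only [coe_filter, mem_product, mem_Ico, Set.mem_ofPred_eq, mem_Ioc]
    rintro ⟨⟨h1, h2⟩, h3⟩
    refine ⟨by omega, ?_⟩
    have hg : 0 < Nat.gcd i k := Nat.gcd_pos_of_pos_left _ hi
    have hc : Nat.Coprime (k / Nat.gcd i k) (i / Nat.gcd i k) :=
      (Nat.coprime_div_gcd_div_gcd hg).symm
    apply hc.dvd_of_dvd_mul_left
    refine ⟨x.2, ?_⟩
    apply Nat.eq_of_mul_eq_mul_left hg
    rw [← mul_assoc, ← mul_assoc, Nat.mul_div_cancel' (Nat.gcd_dvd_left i k),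
      Nat.mul_div_cancel' (Nat.gcd_dvd_right i k), h3]
  · rintro ⟨x, y⟩ hx ⟨x', y'⟩ hx' h
    simp only [coe_filter, Set.mem_ofPred_eq] at hx hx' h
    subst h
    have : k * y = k * y' := by rw [← hx.2, ← hx'.2]
    rw [Nat.eq_of_mul_eq_mul_left (by omega) this]

open Finset in
lemma mt_pair (i k n : ℕ) (hi : 1 ≤ i) (hk : 1 ≤ k) :
    #{x ∈ Ico 1 (n + 1) ×ˢ Ico 1 (n + 1) | i * x.1 = k * x.2} ≤ n / (max i k / Nat.gcd i k) := by
  rcases le_total i k with h | h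
  · rw [max_eq_right h]; exact mt_pair_aux i k n hi h
  · rw [max_eq_left h, Nat.gcd_comm]
    refine le_trans (le_of_eq ?_) (mt_pair_aux k i n hk h)
    apply card_nbij' (fun x => (x.2, x.1)) (fun x => (x.2, x.1)) <;>
      simp [Set.MapsTo, Set.LeftInvOn] <;> grind

open Finset in
lemma mt_energy (a N : ℕ) (ha : 1 ≤ a) (hN : a < N) :
    mulEnergy (Ico a N) (Ico 1 N) ≤ mtE a N := by
  obtain ⟨n, rfl⟩ : ∃ n, N = n + 1 := ⟨N - 1, by omega⟩
  have h0 : mulEnergy (Ico a (n+1)) (Ico 1 (n+1)) = ∑ i ∈ Ico a (n+1), ∑ k ∈ Ico a (n+1),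
      #{x ∈ Ico 1 (n + 1) ×ˢ Ico 1 (n + 1) | i * x.1 = k * x.2} := by
    unfold mulEnergy
    simp only [card_filter]
    rw [sum_product, sum_product]
  rw [h0]
  unfold mtE
  rw [sum_Ico_eq_sum_range]
  apply sum_le_sum
  intro i _
  rw [sum_Ico_eq_sum_range]
  apply sum_le_sum
  intro j _
  exact mt_pair _ _ _ (by omega) (by omega)

open Finset Pointwise in
lemma mt_main (a N : ℕ) (ha : 1 ≤ a) (hN : a < N) :
    (N - a) ^ 2 * (N - 1) ^ 2 ≤ (multTable N - 1) * mtE a N := by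
  have h1 := le_card_mul_mul_mulEnergy (Ico a N) (Ico 1 N)
  rw [Nat.card_Ico, Nat.card_Ico] at h1
  refine h1.trans (Nat.mul_le_mul ?_ (mt_energy a N ha hN))
  apply Nat.le_sub_one_of_lt
  unfold multTable
  apply card_lt_card
  rw [Finset.ssubset_iff_of_subset]
  · refine ⟨0, ?_, ?_⟩
    · simp only [mem_image, mem_product, mem_range]
      exact ⟨(0, 0), by simp; omega, rfl⟩
    · simp only [Finset.mem_mul, mem_Ico, not_exists]
      rintro x ⟨hx, y, hy, h⟩
      rcases Nat.mul_eq_zero.1 h with h | h <;> omega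
  · intro z
    simp only [Finset.mem_mul, mem_Ico, mem_image, mem_product, mem_range]
    rintro ⟨x, hx, y, hy, h⟩
    exact ⟨(x, y), by simp; omega, h⟩

open Finset in
lemma mt_mono {N N' : ℕ} (h : N ≤ N') : multTable N ≤ multTable N' := by
  unfold multTable
  apply card_le_card
  apply image_subset_image
  apply product_subset_product <;> simpa using h

lemma mt_range (N₀ N₁ v p N : ℕ) (h0 : 2 ≤ N₀) (hv : v ≤ multTable N₀) (hp : 2 ^ p ≤ N₀ ^ 10)
    (hc : N₁ ^ 2 * 100000 ≤ v * 2 * p * 6931) (h1 : N₀ ≤ N) (h2 : N ≤ N₁) :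
    (N : ℝ) ^ 2 / (2 * Real.log N) ≤ multTable N := by
  have hN0 : (2 : ℝ) ≤ N₀ := by exact_mod_cast h0
  have hN0N : (N₀ : ℝ) ≤ N := by exact_mod_cast h1
  have hNN1 : (N : ℝ) ≤ N₁ := by exact_mod_cast h2
  have hl : (p : ℝ) * Real.log 2 ≤ 10 * Real.log N := by
    have h3 : (2 : ℝ) ^ p ≤ (N : ℝ) ^ 10 := by
      calc (2 : ℝ) ^ p ≤ (N₀ : ℝ) ^ 10 := by exact_mod_cast hp
        _ ≤ _ := by gcongr
    have := Real.log_le_log (by positivity) h3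
    rw [Real.log_pow, Real.log_pow] at this
    exact_mod_cast this
  have hl2 := Real.log_two_gt_d9
  have hpos : 0 < Real.log N := Real.log_pos (by linarith)
  have hl3 : (p : ℝ) * 0.6931 ≤ 10 * Real.log N := by
    refine le_trans ?_ hl
    gcongr
    linarith
  have hvm : (v : ℝ) ≤ multTable N := by exact_mod_cast hv.trans (mt_mono h1)
  rw [div_le_iff₀ (by positivity)]
  have hc' : (N₁ : ℝ) ^ 2 * 100000 ≤ v * 2 * p * 6931 := by exact_mod_cast hc
  have h5 : (N : ℝ) ^ 2 ≤ (N₁ : ℝ) ^ 2 := by gcongr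
  have h6 : (v : ℝ) * (p * 0.6931) ≤ v * (10 * Real.log N) := by gcongr
  have h7 : (v : ℝ) * (2 * Real.log N) ≤ multTable N * (2 * Real.log N) := by gcongr
  nlinarith

/-- Row sums, by recursion, for evaluation. -/
def mtRow (n a j : ℕ) : ℕ → ℕ
  | 0 => 0
  | i + 1 => mtRow n a j i + n / ((a + j) / Nat.gcd (a + i) (a + j))

/-- Sum over the pairs below the diagonal, by recursion, for evaluation. -/
def mtTri (n a : ℕ) : ℕ → ℕ
  | 0 => 0
  | j + 1 => mtTri n a j + mtRow n a j j

open Finset in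
lemma mtRow_eq (n a j k : ℕ) :
    mtRow n a j k = ∑ i ∈ range k, n / ((a + j) / Nat.gcd (a + i) (a + j)) := by
  induction k with
  | zero => simp [mtRow, mtTri]
  | succ k ih => rw [mtRow, ih, sum_range_succ]

open Finset in
lemma mtTri_eq (n a K : ℕ) (ha : 1 ≤ a) :
    ∑ i ∈ range K, ∑ j ∈ range K, n / (max (a + i) (a + j) / Nat.gcd (a + i) (a + j)) =
      K * n + 2 * mtTri n a K := by
  induction K with
  | zero => simp [mtRow, mtTri]
  | succ K ih =>
    rw [sum_range_succ]
    simp only [sum_range_succ _ K]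
    rw [sum_add_distrib, ih, mtTri, mtRow_eq]
    have h1 : ∑ i ∈ range K, n / (max (a + i) (a + K) / Nat.gcd (a + i) (a + K)) =
        ∑ i ∈ range K, n / ((a + K) / Nat.gcd (a + i) (a + K)) := by
      apply sum_congr rfl
      intro i hi
      rw [mem_range] at hi
      rw [max_eq_right (by omega)]
    have h2 : ∑ i ∈ range K, n / (max (a + K) (a + i) / Nat.gcd (a + K) (a + i)) =
        ∑ i ∈ range K, n / ((a + K) / Nat.gcd (a + i) (a + K)) := by
      apply sum_congr rfl
      intro i hi
      rw [mem_range] at hi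
      rw [max_eq_left (by omega), Nat.gcd_comm]
    have h3 : n / (max (a + K) (a + K) / Nat.gcd (a + K) (a + K)) = n := by
      rw [max_self, Nat.gcd_self, Nat.div_self (by omega), Nat.div_one]
    rw [h1, h2, h3]
    ring

lemma mt_ge (K a n v : ℕ) (ha : 1 ≤ a) (hN : a + K = n + 1) (hK : 1 ≤ K)
    (h : v * (K * n + 2 * mtTri n a K) < K ^ 2 * n ^ 2) : v + 2 ≤ multTable (n + 1) := by
  have h0 := mt_main a (n + 1) ha (by omega)
  have e1 : n + 1 - a = K := by omega
  rw [mtE, e1, Nat.add_sub_cancel, mtTri_eq _ _ _ ha] at h0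
  have := Nat.lt_of_mul_lt_mul_right (h.trans_le h0)
  omega

lemma mt_small (N : ℕ) (hN : 4 ≤ N) (hN' : N ≤ 991) :
    (N : ℝ) ^ 2 / (2 * Real.log N) ≤ multTable N := by
  by_cases h0 : N ≤ 4
  · exact mt_range 4 4 7 20 N (by norm_num)
      (by decide +kernel)
      (by norm_num) (by norm_num) (by omega) (by omega)
  by_cases h1 : N ≤ 5
  · exact mt_range 5 5 10 23 N (by norm_num)
      (by decide +kernel)
      (by norm_num) (by norm_num) (by omega) (by omega)
  by_cases h2 : N ≤ 7
  · exact mt_range 6 7 15 25 N (by norm_num)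
      (by decide +kernel)
      (by norm_num) (by norm_num) (by omega) (by omega)
  by_cases h3 : N ≤ 10
  · exact mt_range 8 10 26 30 N (by norm_num)
      (by decide +kernel)
      (by norm_num) (by norm_num) (by omega) (by omega)
  by_cases h4 : N ≤ 12
  · exact mt_range 11 12 31 34 N (by norm_num)
      (mt_ge 4 7 10 29 (by norm_num) (by norm_num) (by norm_num) (by decide +kernel))
      (by norm_num) (by norm_num) (by omega) (by omega)
  by_cases h5 : N ≤ 15
  · exact mt_range 13 15 46 37 N (by norm_num)
      (mt_ge 6 7 12 44 (by norm_num) (by norm_num) (by norm_num) (by decide +kernel))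
      (by norm_num) (by norm_num) (by omega) (by omega)
  by_cases h6 : N ≤ 19
  · exact mt_range 16 19 68 40 N (by norm_num)
      (mt_ge 8 8 15 66 (by norm_num) (by norm_num) (by norm_num) (by decide +kernel))
      (by norm_num) (by norm_num) (by omega) (by omega)
  by_cases h7 : N ≤ 24
  · exact mt_range 20 24 97 43 N (by norm_num)
      (mt_ge 7 13 19 95 (by norm_num) (by norm_num) (by norm_num) (by decide +kernel))
      (by norm_num) (by norm_num) (by omega) (by omega)
  by_cases h8 : N ≤ 30
  · exact mt_range 25 30 142 46 N (by norm_num)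
      (mt_ge 10 15 24 140 (by norm_num) (by norm_num) (by norm_num) (by decide +kernel))
      (by norm_num) (by norm_num) (by omega) (by omega)
  by_cases h9 : N ≤ 38
  · exact mt_range 31 38 214 49 N (by norm_num)
      (mt_ge 12 19 30 212 (by norm_num) (by norm_num) (by norm_num) (by decide +kernel))
      (by norm_num) (by norm_num) (by omega) (by omega)
  by_cases h10 : N ≤ 48
  · exact mt_range 39 48 321 52 N (by norm_num)
      (mt_ge 13 26 38 319 (by norm_num) (by norm_num) (by norm_num) (by decide +kernel))
      (by norm_num) (by norm_num) (by omega) (by omega)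
  by_cases h11 : N ≤ 62
  · exact mt_range 49 62 505 56 N (by norm_num)
      (mt_ge 18 31 48 503 (by norm_num) (by norm_num) (by norm_num) (by decide +kernel))
      (by norm_num) (by norm_num) (by omega) (by omega)
  by_cases h12 : N ≤ 81
  · exact mt_range 63 81 812 59 N (by norm_num)
      (mt_ge 23 40 62 810 (by norm_num) (by norm_num) (by norm_num) (by decide +kernel))
      (by norm_num) (by norm_num) (by omega) (by omega)
  by_cases h13 : N ≤ 104
  · exact mt_range 82 104 1243 63 N (by norm_num)
      (mt_ge 28 54 81 1241 (by norm_num) (by norm_num) (by norm_num) (by decide +kernel))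
      (by norm_num) (by norm_num) (by omega) (by omega)
  by_cases h14 : N ≤ 138
  · exact mt_range 105 138 2065 67 N (by norm_num)
      (mt_ge 37 68 104 2063 (by norm_num) (by norm_num) (by norm_num) (by decide +kernel))
      (by norm_num) (by norm_num) (by omega) (by omega)
  by_cases h15 : N ≤ 181
  · exact mt_range 139 181 3339 71 N (by norm_num)
      (mt_ge 42 97 138 3337 (by norm_num) (by norm_num) (by norm_num) (by decide +kernel))
      (by norm_num) (by norm_num) (by omega) (by omega)
  by_cases h16 : N ≤ 240
  · exact mt_range 182 240 5584 75 N (by norm_num)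
      (mt_ge 57 125 181 5582 (by norm_num) (by norm_num) (by norm_num) (by decide +kernel))
      (by norm_num) (by norm_num) (by omega) (by omega)
  by_cases h17 : N ≤ 325
  · exact mt_range 241 325 9667 79 N (by norm_num)
      (mt_ge 80 161 240 9665 (by norm_num) (by norm_num) (by norm_num) (by decide +kernel))
      (by norm_num) (by norm_num) (by omega) (by omega)
  by_cases h18 : N ≤ 441
  · exact mt_range 326 441 16926 83 N (by norm_num)
      (mt_ge 105 221 325 16924 (by norm_num) (by norm_num) (by norm_num) (by decide +kernel))
      (by norm_num) (by norm_num) (by omega) (by omega)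
  by_cases h19 : N ≤ 588
  · exact mt_range 442 588 28735 87 N (by norm_num)
      (mt_ge 127 315 441 28733 (by norm_num) (by norm_num) (by norm_num) (by decide +kernel))
      (by norm_num) (by norm_num) (by omega) (by omega)
  by_cases h20 : N ≤ 797
  · exact mt_range 589 797 49874 92 N (by norm_num)
      (mt_ge 169 420 588 49872 (by norm_num) (by norm_num) (by norm_num) (by decide +kernel))
      (by norm_num) (by norm_num) (by omega) (by omega)
  · exact mt_range 798 991 74400 96 N (by norm_num)
      (mt_ge 150 648 797 74398 (by norm_num) (by norm_num) (by norm_num) (by decide +kernel))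
      (by norm_num) (by norm_num) (by omega) (by omega)

open Finset in
lemma mt_gcd_sum (a N : ℕ) (ha : 1 ≤ a) (hN : a < N) :
    ((∑ x ∈ (Ico a N).offDiag, Nat.gcd x.1 x.2 : ℕ) : ℝ) ≤
      ((N - 1 - a : ℕ) : ℝ) ^ 2 * ((harmonic (N - 1 - a) : ℚ) + 1) := by
  set m := N - 1 - a with hm
  have h1 : ∑ x ∈ (Ico a N).offDiag, Nat.gcd x.1 x.2 ≤
      ∑ x ∈ (Ico a N).offDiag, ∑ d ∈ Icc 1 m, if d ∣ x.1 ∧ d ∣ x.2 then d else 0 := by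
    apply sum_le_sum
    rintro ⟨x, y⟩ hx
    simp only [mem_offDiag, mem_Ico] at hx
    have hg : 0 < Nat.gcd x y := Nat.gcd_pos_of_pos_left _ (by omega)
    have hgm : Nat.gcd x y ≤ m := by
      rcases lt_or_gt_of_ne hx.2.2 with h | h
      · have := Nat.le_of_dvd (by omega) (Nat.dvd_sub (Nat.gcd_dvd_right x y) (Nat.gcd_dvd_left x y))
        omega
      · have := Nat.le_of_dvd (by omega) (Nat.dvd_sub (Nat.gcd_dvd_left x y) (Nat.gcd_dvd_right x y))
        omega
    refine le_trans ?_ (single_le_sum (f := fun d => if d ∣ x ∧ d ∣ y then d else 0)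
      (fun _ _ => Nat.zero_le _) (mem_Icc.2 ⟨hg, hgm⟩))
    simp [Nat.gcd_dvd_left, Nat.gcd_dvd_right]
  have h2 : ∑ x ∈ (Ico a N).offDiag, ∑ d ∈ Icc 1 m, (if d ∣ x.1 ∧ d ∣ x.2 then d else 0) ≤
      ∑ d ∈ Icc 1 m, d * (#{x ∈ Ico a N | d ∣ x} * (#{x ∈ Ico a N | d ∣ x} - 1)) := by
    rw [sum_comm]
    apply sum_le_sum
    intro d _
    rw [← sum_filter, sum_const, smul_eq_mul, mul_comm, Nat.mul_sub_one, ← offDiag_card]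
    apply Nat.mul_le_mul_left
    apply card_le_card
    rintro ⟨x, y⟩
    simp only [mem_filter, mem_offDiag]
    tauto
  have h3 : ∀ d ∈ Icc 1 m, ((d * (#{x ∈ Ico a N | d ∣ x} * (#{x ∈ Ico a N | d ∣ x} - 1)) : ℕ) : ℝ) ≤
      (m : ℝ) ^ 2 * (d : ℝ)⁻¹ + m := by
    intro d hd
    have hd1 := (mem_Icc.1 hd).1
    have hc := mt_count a N d ha hN hd1
    rw [← hm] at hc
    generalize #{x ∈ Ico a N | d ∣ x} = c at hc
    rcases c with _ | c
    · simp; positivity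
    · have hdr : (0 : ℝ) < d := by exact_mod_cast hd1
      have h4 : (d : ℝ) * c ≤ m := by
        have : d * c ≤ m := by rw [mul_add] at hc; omega
        exact_mod_cast this
      have h5 : (c : ℝ) ≤ m * (d : ℝ)⁻¹ := by
        rw [← div_eq_mul_inv, le_div_iff₀ hdr]; linarith
      push_cast
      calc (d : ℝ) * ((c + 1) * c) = (d * c) * (c + 1) := by ring
        _ ≤ m * (m * (d : ℝ)⁻¹ + 1) := by gcongr
        _ = _ := by ring
  calc ((∑ x ∈ (Ico a N).offDiag, Nat.gcd x.1 x.2 : ℕ) : ℝ)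
      ≤ ((∑ d ∈ Icc 1 m, d * (#{x ∈ Ico a N | d ∣ x} * (#{x ∈ Ico a N | d ∣ x} - 1)) : ℕ) : ℝ) := by
        exact_mod_cast h1.trans h2
    _ ≤ ∑ d ∈ Icc 1 m, ((m : ℝ) ^ 2 * (d : ℝ)⁻¹ + m) := by
        rw [Nat.cast_sum]; exact sum_le_sum h3
    _ = _ := by
        rw [sum_add_distrib, ← mul_sum, harmonic_eq_sum_Icc]
        simp
        ring

open Finset in
lemma mt_E_le (a N : ℕ) (ha : 1 ≤ a) (hN : a < N) :
    (mtE a N : ℝ) ≤ ((N - a : ℕ) : ℝ) * ((N - 1 : ℕ) : ℝ) +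
      ((N - 1 : ℕ) : ℝ) / a * (∑ x ∈ (Ico a N).offDiag, Nat.gcd x.1 x.2 : ℕ) := by
  have h0 : mtE a N = ∑ x ∈ Ico a N ×ˢ Ico a N, (N - 1) / (max x.1 x.2 / Nat.gcd x.1 x.2) := by
    rw [sum_product, sum_Ico_eq_sum_range]
    simp only [sum_Ico_eq_sum_range]
    rfl
  rw [h0, ← diag_union_offDiag, sum_union (disjoint_diag_offDiag _), Nat.cast_add]
  apply add_le_add
  · have : ∑ x ∈ (Ico a N).diag, (N - 1) / (max x.1 x.2 / Nat.gcd x.1 x.2) = (N - a) * (N - 1) := by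
      rw [sum_congr rfl (g := fun _ => N - 1)]
      · simp
      · rintro ⟨x, y⟩ hx
        simp only [mem_diag, mem_Ico] at hx
        obtain ⟨hx, rfl⟩ := hx
        simp [Nat.div_self (show 0 < x by omega)]
    rw [this]; push_cast; rfl
  · push_cast
    rw [mul_sum]
    apply sum_le_sum
    rintro ⟨x, y⟩ hx
    simp only [mem_offDiag, mem_Ico] at hx
    have hg : 0 < Nat.gcd x y := Nat.gcd_pos_of_pos_left _ (by omega)
    have hgd : Nat.gcd x y ∣ max x y := by
      rcases max_choice x y with h | h <;> rw [h]
      · exact Nat.gcd_dvd_left x y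
      · exact Nat.gcd_dvd_right x y
    have ham : (a : ℝ) ≤ (max x y : ℕ) := by exact_mod_cast hx.1.1.trans (le_max_left x y)
    have har : (0 : ℝ) < a := by exact_mod_cast ha
    have hgr : (0 : ℝ) < Nat.gcd x y := by exact_mod_cast hg
    refine Nat.cast_div_le.trans ?_
    rw [Nat.cast_div hgd hgr.ne', div_div_eq_mul_div, div_mul_eq_mul_div]
    gcongr

set_option maxHeartbeats 1000000 in
lemma mt_large (N : ℕ) (hN : 960 ≤ N) :
    (N : ℝ) ^ 2 / (2 * Real.log N) ≤ multTable N := by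
  obtain ⟨K, hK⟩ : ∃ K, K = N / 4 := ⟨_, rfl⟩
  obtain ⟨a, haN⟩ : ∃ a, a + K = N := ⟨N - K, by omega⟩
  have ha : 1 ≤ a := by omega
  have haN' : a < N := by omega
  have hmain := mt_main a N ha haN'
  have hE := mt_E_le a N ha haN'
  have hG := mt_gcd_sum a N ha haN'
  have e1 : N - a = K := by omega
  have e2 : N - 1 - a = K - 1 := by omega
  rw [e1] at hmain hE
  rw [e2] at hG
  have hNr : (960 : ℝ) ≤ N := by exact_mod_cast hN
  have hK4 : (4 : ℝ) * K ≤ N := by exact_mod_cast (show 4 * K ≤ N by omega)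
  have hK3 : (N : ℝ) - 3 ≤ 4 * K := by
    have : (N : ℝ) ≤ 4 * K + 3 := by exact_mod_cast (show N ≤ 4 * K + 3 by omega)
    linarith
  have har : (3 : ℝ) * N ≤ 4 * a := by exact_mod_cast (show 3 * N ≤ 4 * a by omega)
  have hn : ((N - 1 : ℕ) : ℝ) = N - 1 := by rw [Nat.cast_sub (by omega)]; simp
  have hKm : ((K - 1 : ℕ) : ℝ) ≤ K := by exact_mod_cast Nat.sub_le K 1
  have hKpos : (0 : ℝ) < K := by linarith
  have hl2 := Real.log_two_gt_d9
  set L := Real.log N with hL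
  have hLlow : 6.86 ≤ L := by
    have h3 : (2 : ℝ) ^ 99 ≤ (N : ℝ) ^ 10 := by
      calc (2 : ℝ) ^ 99 ≤ (960 : ℝ) ^ 10 := by norm_num
        _ ≤ _ := by gcongr
    have := Real.log_le_log (by positivity) h3
    rw [Real.log_pow, Real.log_pow] at this
    push_cast at this
    linarith
  have hH : ((harmonic (K - 1) : ℚ) : ℝ) ≤ L - 2 * Real.log 2 + 2 / 3 := by
    have h6 : Real.eulerMascheroniSeq' (K - 1) ≤ Real.eulerMascheroniSeq' 6 :=
      Real.strictAnti_eulerMascheroniSeq'.antitone (by omega)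
    have h7 := Real.eulerMascheroniSeq'_six_lt_two_thirds
    rw [Real.eulerMascheroniSeq', if_neg (by omega)] at h6
    have h8 : Real.log ((K - 1 : ℕ) : ℝ) ≤ L - 2 * Real.log 2 := by
      have h9 : Real.log ((K - 1 : ℕ) : ℝ) ≤ Real.log (N / 2 ^ 2) := by
        apply Real.log_le_log
        · exact_mod_cast (show 0 < K - 1 by omega)
        · linarith
      rw [Real.log_div (by linarith) (by norm_num), Real.log_pow] at h9
      exact_mod_cast h9
    linarith
  have hG' : ((∑ x ∈ (Finset.Ico a N).offDiag, Nat.gcd x.1 x.2 : ℕ) : ℝ) ≤ (K : ℝ) ^ 2 * (L + 0.2804) := by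
    refine hG.trans ?_
    apply mul_le_mul
    · gcongr
    · linarith
    · have : (0 : ℚ) ≤ harmonic (K - 1) := by
        unfold harmonic; positivity
      have : (0 : ℝ) ≤ (harmonic (K - 1) : ℚ) := by exact_mod_cast this
      linarith
    · positivity
  rw [hn] at hE
  have hapos : (0 : ℝ) < a := by linarith
  have hE' : (mtE a N : ℝ) ≤ K * (N - 1) * (1 + 4 * K / (3 * N) * (L + 0.2804)) := by
    refine hE.trans ?_
    have : ((N : ℝ) - 1) / a ≤ (N - 1) * (4 / (3 * N)) := by
      rw [div_eq_mul_inv]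
      apply mul_le_mul_of_nonneg_left _ (by linarith)
      rw [inv_eq_one_div, div_le_div_iff₀ hapos (by linarith)]
      linarith
    calc _ ≤ (K : ℝ) * (N - 1) + (N - 1) * (4 / (3 * N)) * ((K : ℝ) ^ 2 * (L + 0.2804)) := by
          gcongr
          apply mul_nonneg <;> [linarith; positivity]
      _ = _ := by ring
  have hm : (K : ℝ) ^ 2 * (N - 1) ^ 2 ≤ multTable N * mtE a N := by
    rw [← hn]
    exact_mod_cast hmain.trans (Nat.mul_le_mul_right _ (Nat.sub_le _ _))
  have hm2 : (K : ℝ) * (N - 1) ≤ multTable N * (1 + 4 * K / (3 * N) * (L + 0.2804)) := by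
    have h1 : (K * (N - 1)) * ((K : ℝ) * (N - 1)) ≤
        (K * (N - 1)) * (multTable N * (1 + 4 * K / (3 * N) * (L + 0.2804))) := by
      have : (multTable N : ℝ) * mtE a N ≤ multTable N * (K * (N - 1) * (1 + 4 * K / (3 * N) * (L + 0.2804))) := by
        gcongr
      nlinarith
    exact le_of_mul_le_mul_left h1 (mul_pos hKpos (by linarith))
  have hLpos : 0 < L := by linarith
  have hD : 0 < 1 + 4 * (K : ℝ) / (3 * N) * (L + 0.2804) := by positivity
  refine le_trans ?_ ((div_le_iff₀ hD).2 hm2)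
  rw [div_le_div_iff₀ (by positivity) hD]
  have hkey : (N : ℝ) ^ 2 + 4 / 3 * (K * N) * (L + 0.2804) ≤ K * (N - 1) * (2 * L) := by
    -- after dividing by K, using N ≤ 4 K + 3
    have h1 : (N : ℝ) ≤ K * (4 + 0.0126) := by linarith
    have h2 : (N : ℝ) * N ≤ K * (4 + 0.0126) * N := by gcongr
    have h3 : 0 ≤ N * (2 / 3 * L - 4.0126 - 4 / 3 * 0.2804) - 2 * L := by
      nlinarith
    have h4 := mul_nonneg hKpos.le h3
    linear_combination h2 + h4
  refine le_trans (le_of_eq ?_) hkey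
  have : (N : ℝ) ≠ 0 := by linarith
  field_simp

/-- `M(N) ≥ N²/(2 log N)` for all `N ≥ 4`. -/
theorem multTable_lower_bound (N : ℕ) (hN : 4 ≤ N) :
    (N : ℝ) ^ 2 / (2 * Real.log N) ≤ multTable N := by
  by_cases h1 : N ≤ 991
  · exact mt_small N hN h1
  · exact mt_large N (by omega)
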